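/- arXiv:2110.12945 — 2 statements merged into one kernel-verified Lean document; each statement's English description precedes it below -/
import Mathlib

section
/- Proposition 1 (tightness of the SDR): Let W̃ and S̃ be N×N complex positive semidefinite matrices and g ∈ ℂ^N a vector with g^H W̃ g > 0. Define w₀* = (g^H W̃ g)^{-1/2} W̃ g, W* = w₀* (w₀*)^H = (W̃ g)(W̃ g)^H / (g^H W̃ g), and S* = W̃ + S̃ − W*. Then: (i) W* is positive semidefinite with rank(W*) ≤ 1; (ii) W̃ − W* and S* − S̃ are positive semidefinite, and in particular S* is positive semidefinite; (iii) W* + S* = W̃ + S̃, so Tr(W*) + Tr(S*) = Tr(W̃) + Tr(S̃); (iv) g^H W* g = g^H W̃ g and g^H S* g = g^H S̃ g; (v) for every h ∈ ℂ^N, every real γ_E ≥ 0 and every real σ² ≥ 0, if h^H W̃ h ≤ γ_E (h^H S̃ h + σ²) then h^H W* h ≤ γ_E (h^H S* h + σ²). Consequently (W*, S*) satisfies every constraint of problem (SDR4.1) that (W̃, S̃) satisfies and, for any fixed scaling factor η and any fixed steering vectors, achieves exactly the same beampattern matching objective value, while additionally having rank(W*) ≤ 1. -/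
open Matrix ComplexOrder

namespace Matrix.PosSemidef

variable {n : Type*} [Fintype n] {A : Matrix n n ℂ}

theorem coe_re_dotProduct_mulVec (hA : A.PosSemidef) (g : n → ℂ) :
    (((star g ⬝ᵥ A *ᵥ g).re : ℝ) : ℂ) = star g ⬝ᵥ A *ᵥ g :=
  (Complex.eq_re_of_ofReal_le (r := 0) (by simpa using hA.dotProduct_mulVec_nonneg g)).symm

theorem re_dotProduct_mulVec_nonneg (hA : A.PosSemidef) (g : n → ℂ) :
    0 ≤ (star g ⬝ᵥ A *ᵥ g).re :=
  (Complex.nonneg_iff.mp (hA.dotProduct_mulVec_nonneg g)).1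

theorem star_mulVec_eq_vecMul (hA : A.PosSemidef) (g : n → ℂ) :
    star (A *ᵥ g) = star g ᵥ* A := by
  rw [star_mulVec, hA.isHermitian.eq]

/-- Removing from a positive semidefinite matrix its rank-one part along `A *ᵥ g` leaves a
positive semidefinite matrix; this is the Cauchy-Schwarz inequality for the form of `A`. -/
theorem sub_inv_smul_vecMulVec [DecidableEq n] (hA : A.PosSemidef) (g : n → ℂ)
    (hg : star g ⬝ᵥ A *ᵥ g ≠ 0) :
    (A - (star g ⬝ᵥ A *ᵥ g)⁻¹ • vecMulVec (A *ᵥ g) (star (A *ᵥ g))).PosSemidef := by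
  have hc : star (star g ⬝ᵥ A *ᵥ g) = star g ⬝ᵥ A *ᵥ g := by
    rw [← hA.coe_re_dotProduct_mulVec g]
    exact Complex.conj_ofReal _
  have hu := hA.star_mulVec_eq_vecMul g
  have hd : star (A *ᵥ g) ⬝ᵥ g = star g ⬝ᵥ A *ᵥ g := by
    rw [hu, dotProduct_mulVec]
  have key := hA.conjTranspose_mul_mul_same
    (1 - (star g ⬝ᵥ A *ᵥ g)⁻¹ • vecMulVec g (star (A *ᵥ g)))
  convert key using 1
  generalize hcdef : star g ⬝ᵥ A *ᵥ g = c at *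
  rw [conjTranspose_sub, conjTranspose_smul, conjTranspose_vecMulVec, conjTranspose_one,
    star_inv₀, hc, star_star]
  simp only [sub_mul, mul_sub, one_mul, mul_one, smul_mul_assoc, mul_smul_comm,
    vecMulVec_mul, mul_vecMulVec, ← hu, vecMulVec_mulVec, hd, smul_smul,
    op_smul_eq_smul, smul_vecMulVec, smul_sub]
  rw [inv_mul_cancel₀ hg, mul_one]
  abel

end Matrix.PosSemidef

/-- Proposition 1 (tightness of the SDR): let `W̃` and `S̃` be `N × N` complex
positive semidefinite matrices and `g ∈ ℂ^N` with `g^H W̃ g > 0`. Define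
`w₀* = (g^H W̃ g)^{-1/2} W̃ g`, `W* = w₀* (w₀*)^H = (W̃ g)(W̃ g)^H / (g^H W̃ g)`,
and `S* = W̃ + S̃ − W*`. Then:
(i) `W*` is positive semidefinite with `rank W* ≤ 1`;
(ii) `W̃ − W*` and `S* − S̃` are positive semidefinite, in particular `S*` is PSD;
(iii) `W* + S* = W̃ + S̃`, so `Tr W* + Tr S* = Tr W̃ + Tr S̃`;
(iv) `g^H W* g = g^H W̃ g` and `g^H S* g = g^H S̃ g`;
(v) for every `h ∈ ℂ^N`, `γ_E ≥ 0`, `σ² ≥ 0`, if `h^H W̃ h ≤ γ_E (h^H S̃ h + σ²)`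
then `h^H W* h ≤ γ_E (h^H S* h + σ²)`.
Consequently, for any scaling factor `η` and fixed steering vectors, `(W*, S*)`
achieves exactly the same beampattern matching objective value as `(W̃, S̃)`. -/
theorem prop1_sdr_tightness {N : ℕ}
    (Wt St : Matrix (Fin N) (Fin N) ℂ) (g : Fin N → ℂ)
    (hWt : Wt.PosSemidef) (hSt : St.PosSemidef)
    (hg : 0 < (star g ⬝ᵥ Wt *ᵥ g).re)
    (w₀ : Fin N → ℂ)
    (hw₀ : w₀ = ((Real.sqrt ((star g ⬝ᵥ Wt *ᵥ g).re) : ℂ))⁻¹ • (Wt *ᵥ g))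
    (Wstar Sstar : Matrix (Fin N) (Fin N) ℂ)
    (hWstar : Wstar = Matrix.vecMulVec w₀ (star w₀))
    (hSstar : Sstar = Wt + St - Wstar) :
    -- W* is also the rescaled outer product (W̃ g)(W̃ g)^H / (g^H W̃ g)
    Wstar = (((star g ⬝ᵥ Wt *ᵥ g).re : ℂ))⁻¹ •
        Matrix.vecMulVec (Wt *ᵥ g) (star (Wt *ᵥ g)) ∧
    -- (i)
    Wstar.PosSemidef ∧ Wstar.rank ≤ 1 ∧
    -- (ii)
    (Wt - Wstar).PosSemidef ∧ (Sstar - St).PosSemidef ∧ Sstar.PosSemidef ∧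
    -- (iii)
    Wstar + Sstar = Wt + St ∧
    Wstar.trace + Sstar.trace = Wt.trace + St.trace ∧
    -- (iv)
    star g ⬝ᵥ Wstar *ᵥ g = star g ⬝ᵥ Wt *ᵥ g ∧
    star g ⬝ᵥ Sstar *ᵥ g = star g ⬝ᵥ St *ᵥ g ∧
    -- (v)
    (∀ (h : Fin N → ℂ) (γE σsq : ℝ), 0 ≤ γE → 0 ≤ σsq →
      (star h ⬝ᵥ Wt *ᵥ h).re ≤ γE * ((star h ⬝ᵥ St *ᵥ h).re + σsq) →
      (star h ⬝ᵥ Wstar *ᵥ h).re ≤ γE * ((star h ⬝ᵥ Sstar *ᵥ h).re + σsq)) ∧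
    -- same beampattern matching objective value
    (∀ (M : ℕ) (a : Fin M → Fin N → ℂ) (Phat : Fin M → ℝ) (η : ℝ),
      ∑ m, (η * Phat m - (star (a m) ⬝ᵥ (Sstar + Wstar) *ᵥ (a m)).re) ^ 2 =
        ∑ m, (η * Phat m - (star (a m) ⬝ᵥ (St + Wt) *ᵥ (a m)).re) ^ 2) := by
  have hcr := hWt.coe_re_dotProduct_mulVec g
  have hc0 : star g ⬝ᵥ Wt *ᵥ g ≠ 0 := by
    intro h
    simp [h] at hg
  have hform : Wstar = (((star g ⬝ᵥ Wt *ᵥ g).re : ℂ))⁻¹ •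
      Matrix.vecMulVec (Wt *ᵥ g) (star (Wt *ᵥ g)) := by
    have hsq : ((Real.sqrt ((star g ⬝ᵥ Wt *ᵥ g).re) : ℂ))⁻¹ *
        ((Real.sqrt ((star g ⬝ᵥ Wt *ᵥ g).re) : ℂ))⁻¹ = (((star g ⬝ᵥ Wt *ᵥ g).re : ℂ))⁻¹ := by
      rw [← mul_inv, ← Complex.ofReal_mul, Real.mul_self_sqrt hg.le]
    have hstar (r : ℝ) : star ((r : ℂ)⁻¹) = (r : ℂ)⁻¹ := by
      rw [star_inv₀]
      exact congrArg _ (Complex.conj_ofReal r)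
    rw [hWstar, hw₀, star_smul, hstar, smul_vecMulVec, vecMulVec_smul, smul_smul, hsq]
  have hW : Wstar.PosSemidef := hWstar ▸ posSemidef_vecMulVec_self_star w₀
  have hdiff : (Wt - Wstar).PosSemidef := by
    rw [hform, hcr]
    exact hWt.sub_inv_smul_vecMulVec g hc0
  have hSdiff : Sstar - St = Wt - Wstar := by
    rw [hSstar]
    abel
  have hS : Sstar = St + (Wt - Wstar) := by
    rw [← hSdiff]
    abel
  have hsum : Wstar + Sstar = Wt + St := by
    rw [hSstar]
    abel
  have hgW : star g ⬝ᵥ Wstar *ᵥ g = star g ⬝ᵥ Wt *ᵥ g := by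
    rw [hform, hcr, smul_mulVec, vecMulVec_mulVec, hWt.star_mulVec_eq_vecMul g,
      ← dotProduct_mulVec, op_smul_eq_smul, smul_smul, inv_mul_cancel₀ hc0, one_smul]
  refine ⟨hform, hW, hWstar ▸ rank_vecMulVec_le _ _, hdiff, hSdiff ▸ hdiff,
    hS ▸ hSt.add hdiff, hsum, ?_, hgW, ?_, ?_, ?_⟩
  · rw [← trace_add, hsum, trace_add]
  · rw [hS, add_mulVec, dotProduct_add, sub_mulVec, dotProduct_sub, hgW, sub_self, add_zero]
  · intro h γE σsq hγ _ hle
    have hd := hdiff.re_dotProduct_mulVec_nonneg h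
    have hSh : (star h ⬝ᵥ Sstar *ᵥ h).re =
        (star h ⬝ᵥ St *ᵥ h).re + (star h ⬝ᵥ (Wt - Wstar) *ᵥ h).re := by
      rw [hS, add_mulVec, dotProduct_add, Complex.add_re]
    have hWh : (star h ⬝ᵥ (Wt - Wstar) *ᵥ h).re =
        (star h ⬝ᵥ Wt *ᵥ h).re - (star h ⬝ᵥ Wstar *ᵥ h).re := by
      rw [sub_mulVec, dotProduct_sub, Complex.sub_re]
    rw [hSh]
    nlinarith [mul_nonneg hγ hd]
  · intro M a Phat η
    rw [add_comm Sstar, hsum, add_comm Wt]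
end

section
/- Constraints (1.1a)–(1.1b) imply the secrecy rate constraint (13a): let W and S be N×N complex positive semidefinite matrices, g, h_k ∈ ℂ^N for k in a finite set K_E, σ₀² > 0 and σ_k² > 0 reals, R₀ ≥ 0 a real, γ_E ≥ 0 a real, and set β = 2^{R₀}(1+γ_E) − 1. If h_k^H W h_k ≤ γ_E (h_k^H S h_k + σ_k²) for every k ∈ K_E, and g^H W g ≥ β (g^H S g + σ₀²), then for every k ∈ K_E: log₂(1 + g^H W g/(g^H S g + σ₀²)) − log₂(1 + h_k^H W h_k/(h_k^H S h_k + σ_k²)) ≥ R₀. -/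
open Matrix ComplexOrder

/-- If `x ≤ γ` and `2 ^ R * (1 + γ) - 1 ≤ y`, then the base-2 logarithms of `1 + y` and `1 + x`
differ by at least `R`. -/
theorem le_logb_two_one_add_sub_logb_two_one_add {R γ x y : ℝ} (hx : 0 ≤ x) (hxγ : x ≤ γ)
    (hy : (2 : ℝ) ^ R * (1 + γ) - 1 ≤ y) :
    R ≤ Real.logb 2 (1 + y) - Real.logb 2 (1 + x) := by
  have hpow : (0 : ℝ) < 2 ^ R := Real.rpow_pos_of_pos two_pos R
  have hx1 : 0 < 1 + x := by linarith
  have hxy : (2 : ℝ) ^ R * (1 + x) ≤ 1 + y := by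
    have := mul_le_mul_of_nonneg_left hxγ hpow.le
    linarith
  have hlog := Real.logb_le_logb_of_le one_lt_two (mul_pos hpow hx1) hxy
  rw [Real.logb_mul hpow.ne' hx1.ne', Real.logb_rpow two_pos (by norm_num)] at hlog
  linarith

/-- Constraints (1.1a)–(1.1b) imply the secrecy rate constraint (13a): let `W` and
`S` be `N × N` complex positive semidefinite matrices, `g, h_k ∈ ℂ^N` for `k` in a
finite set `K_E`, `σ₀² > 0` and `σ_k² > 0` reals, `R₀ ≥ 0` a real, `γ_E ≥ 0` a
real, and set `β = 2^{R₀}(1+γ_E) − 1`. If `h_k^H W h_k ≤ γ_E (h_k^H S h_k + σ_k²)`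
for every `k ∈ K_E`, and `g^H W g ≥ β (g^H S g + σ₀²)`, then for every `k ∈ K_E`:
`log₂(1 + g^H W g/(g^H S g + σ₀²)) − log₂(1 + h_k^H W h_k/(h_k^H S h_k + σ_k²)) ≥ R₀`. -/
theorem sinr_constraints_imply_secrecy_rate {N : ℕ} {ι : Type*} [Fintype ι]
    (W S : Matrix (Fin N) (Fin N) ℂ) (hW : W.PosSemidef) (hS : S.PosSemidef)
    (g : Fin N → ℂ) (h : ι → Fin N → ℂ)
    (σ₀sq : ℝ) (σsq : ι → ℝ) (hσ₀ : 0 < σ₀sq) (hσ : ∀ k, 0 < σsq k)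
    (R₀ γE β : ℝ) (hR₀ : 0 ≤ R₀) (hγE : 0 ≤ γE)
    (hβ : β = (2 : ℝ) ^ R₀ * (1 + γE) - 1)
    (heav : ∀ k, (star (h k) ⬝ᵥ W *ᵥ (h k)).re ≤
      γE * ((star (h k) ⬝ᵥ S *ᵥ (h k)).re + σsq k))
    (hcu : (star g ⬝ᵥ W *ᵥ g).re ≥ β * ((star g ⬝ᵥ S *ᵥ g).re + σ₀sq)) :
    ∀ k, Real.logb 2 (1 + (star g ⬝ᵥ W *ᵥ g).re / ((star g ⬝ᵥ S *ᵥ g).re + σ₀sq)) -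
        Real.logb 2 (1 + (star (h k) ⬝ᵥ W *ᵥ (h k)).re /
          ((star (h k) ⬝ᵥ S *ᵥ (h k)).re + σsq k)) ≥ R₀ := by
  intro k
  have hre {A : Matrix (Fin N) (Fin N) ℂ} (hA : A.PosSemidef) (v : Fin N → ℂ) :
      0 ≤ (star v ⬝ᵥ A *ᵥ v).re := hA.re_dotProduct_nonneg v
  have hg : 0 < (star g ⬝ᵥ S *ᵥ g).re + σ₀sq := add_pos_of_nonneg_of_pos (hre hS g) hσ₀
  have hk : 0 < (star (h k) ⬝ᵥ S *ᵥ (h k)).re + σsq k :=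
    add_pos_of_nonneg_of_pos (hre hS (h k)) (hσ k)
  refine le_logb_two_one_add_sub_logb_two_one_add (γ := γE) (div_nonneg (hre hW (h k)) hk.le)
    ((div_le_iff₀ hk).2 (heav k)) ?_
  rw [← hβ]
  exact (le_div_iff₀ hg).2 hcu
end
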